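/- The set E = {x ∈ (0,1)∖ℚ : a_m(x) ≠ a_n(x) for all m ≠ n} of irrationals with pairwise distinct regular continued fraction digits has Hausdorff dimension 1/2. -/

import Mathlib

open Filter Set

/-- The Gauss map `x ↦ {1/x}`. -/
noncomputable def gaussMap (x : ℝ) : ℝ := Int.fract x⁻¹

/-- The `(n+1)`-st regular continued fraction digit of `x` (so `cfDigit 0 x = a₁(x)`). -/
noncomputable def cfDigit (n : ℕ) (x : ℝ) : ℕ := ⌊(gaussMap^[n] x)⁻¹⌋₊

open MeasureTheory
open scoped ENNReal NNReal Topology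

/-- Inverse branches of the Gauss map. -/
noncomputable def cfBranch (k : ℕ) (x : ℝ) : ℝ := ((k : ℝ) + x)⁻¹

/-- The irrationals in the unit interval. -/
def cfU : Set ℝ := {x | x ∈ Set.Ioo (0 : ℝ) 1 ∧ Irrational x}

/-- Irrationals all of whose digits are at least `N`. -/
def cfF (N : ℕ) : Set ℝ := {x | x ∈ cfU ∧ ∀ i, N ≤ cfDigit i x}

lemma cfDigit_gauss (i : ℕ) (x : ℝ) : cfDigit i (gaussMap x) = cfDigit (i + 1) x := rfl

lemma inv_sub_le {a b c : ℝ} (hc : 0 < c) (ha : c ≤ a) (hb : c ≤ b) :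
    |a⁻¹ - b⁻¹| ≤ (c ^ 2)⁻¹ * |a - b| := by
  have ha0 : 0 < a := hc.trans_le ha
  have hb0 : 0 < b := hc.trans_le hb
  have : a⁻¹ - b⁻¹ = (a * b)⁻¹ * (b - a) := by field_simp
  rw [this, abs_mul, abs_sub_comm b a, abs_of_pos (by positivity : 0 < (a * b)⁻¹)]
  gcongr
  nlinarith

lemma cfBranch_lip {k : ℕ} (hk : 1 ≤ k) :
    LipschitzOnWith (((k : ℝ≥0) ^ 2)⁻¹) (cfBranch k) (Set.Icc 0 1) := by
  apply LipschitzOnWith.of_dist_le_mul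
  intro x hx y hy
  have hk' : (0 : ℝ) < k := by exact_mod_cast hk
  have := inv_sub_le (a := k + x) (b := k + y) hk' (by linarith [hx.1]) (by linarith [hy.1])
  simpa [Real.dist_eq, cfBranch] using this

lemma cfBranch_mem {k : ℕ} (hk : 1 ≤ k) {x : ℝ} (hx : x ∈ Set.Icc (0 : ℝ) 1) :
    cfBranch k x ∈ Set.Icc (0 : ℝ) 1 := by
  have hk' : (1 : ℝ) ≤ k := by exact_mod_cast hk
  have h := hx.1
  constructor
  · unfold cfBranch; positivity
  · exact inv_le_one_of_one_le₀ (by linarith)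

lemma cfU_step {x : ℝ} (hx : x ∈ cfU) :
    gaussMap x ∈ cfU ∧ 1 ≤ cfDigit 0 x ∧ cfBranch (cfDigit 0 x) (gaussMap x) = x := by
  obtain ⟨⟨h0, h1⟩, hi⟩ := hx
  have hinv : 1 ≤ x⁻¹ := (one_le_inv₀ h0).2 h1.le
  have hirr : Irrational (gaussMap x) := by
    unfold gaussMap Int.fract
    exact (hi.inv).sub_intCast _
  refine ⟨⟨⟨?_, Int.fract_lt_one _⟩, hirr⟩, ?_, ?_⟩
  · exact lt_of_le_of_ne (Int.fract_nonneg _) (fun h => hirr.ne_zero h.symm)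
  · exact Nat.le_floor (by simpa [cfDigit] using hinv)
  · have : ((cfDigit 0 x : ℕ) : ℝ) = (⌊x⁻¹⌋ : ℝ) := by
      simp only [cfDigit, Function.iterate_zero, id]
      exact natCast_floor_eq_intCast_floor (by positivity)
    rw [cfBranch, this, gaussMap, Int.floor_add_fract, inv_inv]

lemma dimH_preim {F : Set ℝ} (hF : F ⊆ cfU) : dimH {x | x ∈ cfU ∧ gaussMap x ∈ F} ≤ dimH F := by
  have hsub : {x | x ∈ cfU ∧ gaussMap x ∈ F} ⊆ ⋃ k : ℕ, cfBranch (k + 1) '' F := by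
    rintro x ⟨hx, hxF⟩
    obtain ⟨_, h1, h2⟩ := cfU_step hx
    refine mem_iUnion.2 ⟨cfDigit 0 x - 1, gaussMap x, hxF, ?_⟩
    rw [Nat.sub_add_cancel h1, h2]
  refine (dimH_mono hsub).trans ?_
  rw [dimH_iUnion]
  refine iSup_le fun k => ?_
  exact ((cfBranch_lip (by omega)).mono (fun x hx => Ioo_subset_Icc_self (hF hx).1)).dimH_image_le

lemma dimH_preim_iter {F : Set ℝ} (m : ℕ) :
    dimH {x | x ∈ cfU ∧ gaussMap^[m] x ∈ F} ≤ dimH F := by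
  induction m with
  | zero => exact dimH_mono (fun x hx => hx.2)
  | succ m ih =>
    refine le_trans (le_trans (dimH_mono ?_)
      (dimH_preim (F := {x | x ∈ cfU ∧ gaussMap^[m] x ∈ F}) (fun x hx => hx.1))) ih
    rintro x ⟨hx, hm⟩
    exact ⟨hx, (cfU_step hx).1, hm⟩

lemma cfF_cover {N : ℕ} (hN : 2 ≤ N) {d : ℝ} (hd : 0 < d)
    (hs : ∑' k : ℕ, (((((k + N : ℕ) : ℝ≥0) ^ 2)⁻¹ : ℝ≥0) : ℝ≥0∞) ^ d ≤ 1) (n : ℕ) :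
    ∃ t : ℕ → Set ℝ, (∀ i, t i ⊆ Set.Icc 0 1) ∧ cfF N ⊆ ⋃ i, t i ∧
      (∀ i, Metric.ediam (t i) ≤ (1 / 2 : ℝ≥0∞) ^ n) ∧ ∑' i, Metric.ediam (t i) ^ d ≤ 1 := by
  induction n with
  | zero =>
    refine ⟨fun i => if i = 0 then Set.Icc 0 1 else ∅, ?_, ?_, ?_, ?_⟩
    · intro i; dsimp only; split_ifs <;> simp
    · intro x hx
      exact mem_iUnion.2 ⟨0, by simpa using Ioo_subset_Icc_self hx.1.1⟩
    · intro i; dsimp only; split_ifs <;> simp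
    · rw [tsum_eq_single 0]
      · simp
      · intro i hi; simp [hi, hd]
  | succ n ih =>
    obtain ⟨t, h1, h2, h3, h4⟩ := ih
    have key : ∀ k i : ℕ, Metric.ediam (cfBranch (k + N) '' t i) ≤
        (((((k + N : ℕ) : ℝ≥0) ^ 2)⁻¹ : ℝ≥0) : ℝ≥0∞) * Metric.ediam (t i) := by
      intro k i
      refine Metric.ediam_le ?_
      rintro _ ⟨x, hx, rfl⟩ _ ⟨y, hy, rfl⟩
      refine ((cfBranch_lip (k := k + N) (by omega)) (h1 i hx) (h1 i hy)).trans ?_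
      gcongr
      exact Metric.edist_le_ediam_of_mem hx hy
    refine ⟨fun j => cfBranch (j.unpair.1 + N) '' t j.unpair.2, ?_, ?_, ?_, ?_⟩
    · rintro j _ ⟨x, hx, rfl⟩
      exact cfBranch_mem (by omega) (h1 _ hx)
    · rintro x ⟨hx, hd⟩
      obtain ⟨g1, g2, g3⟩ := cfU_step hx
      have : gaussMap x ∈ cfF N := ⟨g1, fun i => hd (i + 1)⟩
      obtain ⟨i, hi⟩ := mem_iUnion.1 (h2 this)
      refine mem_iUnion.2 ⟨Nat.pair (cfDigit 0 x - N) i, gaussMap x, by simpa using hi, ?_⟩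
      simp only [Nat.unpair_pair]
      rw [Nat.sub_add_cancel (hd 0), g3]
    · intro j
      refine (key _ _).trans ?_
      rw [pow_succ (1 / 2 : ℝ≥0∞), mul_comm]
      have h5 : (((((j.unpair.1 + N : ℕ) : ℝ≥0) ^ 2)⁻¹ : ℝ≥0) : ℝ≥0∞) ≤ 1 / 2 := by
        rw [one_div, ← ENNReal.coe_ofNat, ← ENNReal.coe_inv (by norm_num)]
        norm_cast
        apply inv_anti₀ (by norm_num)
        norm_cast
        nlinarith [Nat.zero_le j.unpair.1]
      exact mul_le_mul' (h3 _) h5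
    · calc ∑' j : ℕ, Metric.ediam (cfBranch (j.unpair.1 + N) '' t j.unpair.2) ^ d
          = ∑' p : ℕ × ℕ, Metric.ediam (cfBranch (p.1 + N) '' t p.2) ^ d := by
            exact Nat.pairEquiv.symm.tsum_eq
              (fun p : ℕ × ℕ => Metric.ediam (cfBranch (p.1 + N) '' t p.2) ^ d)
        _ ≤ ∑' p : ℕ × ℕ, (((((p.1 + N : ℕ) : ℝ≥0) ^ 2)⁻¹ : ℝ≥0) : ℝ≥0∞) ^ d *
              Metric.ediam (t p.2) ^ d := by
            refine ENNReal.tsum_le_tsum fun p => ?_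
            rw [← ENNReal.mul_rpow_of_nonneg _ _ hd.le]
            exact ENNReal.rpow_le_rpow (key _ _) hd.le
        _ = ∑' k : ℕ, (((((k + N : ℕ) : ℝ≥0) ^ 2)⁻¹ : ℝ≥0) : ℝ≥0∞) ^ d *
              ∑' i, Metric.ediam (t i) ^ d := by
            rw [ENNReal.tsum_prod (f := fun k i : ℕ =>
              (((((k + N : ℕ) : ℝ≥0) ^ 2)⁻¹ : ℝ≥0) : ℝ≥0∞) ^ d * Metric.ediam (t i) ^ d)]
            simp_rw [ENNReal.tsum_mul_left]
        _ = (∑' k : ℕ, (((((k + N : ℕ) : ℝ≥0) ^ 2)⁻¹ : ℝ≥0) : ℝ≥0∞) ^ d) *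
              ∑' i, Metric.ediam (t i) ^ d := by rw [ENNReal.tsum_mul_right]
        _ ≤ 1 * 1 := by gcongr
        _ = 1 := one_mul 1

lemma dimH_cfF {N : ℕ} (hN : 2 ≤ N) {d : ℝ≥0} (hd : 0 < d)
    (hs : ∑' k : ℕ, (((((k + N : ℕ) : ℝ≥0) ^ 2)⁻¹ : ℝ≥0) : ℝ≥0∞) ^ (d : ℝ) ≤ 1) :
    dimH (cfF N) ≤ d := by
  choose t h1 h2 h3 h4 using cfF_cover hN (d := (d : ℝ)) (by exact_mod_cast hd) hs
  apply dimH_le_of_hausdorffMeasure_ne_top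
  have := MeasureTheory.Measure.hausdorffMeasure_le_liminf_tsum (ι := fun _ : ℕ => ℕ) (d : ℝ)
    (cfF N) (l := atTop) (fun n : ℕ => (1 / 2 : ℝ≥0∞) ^ n)
    (ENNReal.tendsto_pow_atTop_nhds_zero_of_lt_one (by simp)) t
    (Eventually.of_forall h3) (Eventually.of_forall h2)
  refine ne_top_of_le_ne_top ENNReal.one_ne_top (this.trans ?_)
  refine (liminf_le_liminf (Eventually.of_forall h4)).trans ?_
  simp

lemma exists_cfN {d : ℝ≥0} (hd : (1 / 2 : ℝ) < d) : ∃ N : ℕ, 2 ≤ N ∧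
    ∑' k : ℕ, (((((k + N : ℕ) : ℝ≥0) ^ 2)⁻¹ : ℝ≥0) : ℝ≥0∞) ^ (d : ℝ) ≤ 1 := by
  obtain ⟨f, hf⟩ : ∃ f : ℕ → ℝ≥0, ∀ n, f n = (((n : ℝ≥0) ^ 2)⁻¹) ^ (d : ℝ) :=
    ⟨fun n => (((n : ℝ≥0) ^ 2)⁻¹) ^ (d : ℝ), fun _ => rfl⟩
  have hsum : Summable f := by
    rw [← NNReal.summable_coe]
    refine (Real.summable_nat_rpow_inv.2 (by linarith : 1 < 2 * (d : ℝ))).congr fun n => ?_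
    rw [hf]
    push_cast
    rw [Real.inv_rpow (by positivity), Real.rpow_mul (by positivity), Real.rpow_two]
  have ht := NNReal.tendsto_sum_nat_add f
  have ht1 : ∀ᶠ i in atTop, ∑' k, f (k + i) < 1 := (tendsto_order.1 ht).2 1 zero_lt_one
  obtain ⟨N, hN, hN2⟩ := (ht1.and (eventually_ge_atTop 2)).exists
  refine ⟨N, hN2, ?_⟩
  have h : ∀ k : ℕ, (((((k + N : ℕ) : ℝ≥0) ^ 2)⁻¹ : ℝ≥0) : ℝ≥0∞) ^ (d : ℝ) =
      ((f (k + N) : ℝ≥0) : ℝ≥0∞) := by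
    intro k
    rw [hf]
    exact (ENNReal.coe_rpow_of_nonneg _ (NNReal.coe_nonneg d)).symm
  rw [tsum_congr h, ← ENNReal.coe_tsum ((NNReal.summable_nat_add_iff N).2 hsum)]
  exact ENNReal.coe_le_one_iff.2 hN.le

lemma upper_bound : dimH {x : ℝ | x ∈ Set.Ioo (0 : ℝ) 1 ∧ Irrational x ∧
    ∀ m n : ℕ, m ≠ n → cfDigit m x ≠ cfDigit n x} ≤ 1 / 2 := by
  refine ENNReal.le_of_forall_pos_le_add ?_
  intro ε hε _
  have hd : (1 / 2 : ℝ) < ((1 / 2 + ε : ℝ≥0) : ℝ) := by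
    push_cast
    have : (0 : ℝ) < ε := hε
    linarith
  obtain ⟨N, hN, hs⟩ := exists_cfN hd
  have h1 := dimH_cfF hN (by positivity) hs
  have h2 : ((1 / 2 + ε : ℝ≥0) : ℝ≥0∞) = 1 / 2 + ε := by
    rw [ENNReal.coe_add, ENNReal.coe_div (by norm_num)]
    simp
  rw [← h2]
  refine le_trans ?_ h1
  have hsub : {x : ℝ | x ∈ Set.Ioo (0 : ℝ) 1 ∧ Irrational x ∧
      ∀ m n : ℕ, m ≠ n → cfDigit m x ≠ cfDigit n x} ⊆
      ⋃ m : ℕ, {x | x ∈ cfU ∧ gaussMap^[m] x ∈ cfF N} := by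
    rintro x ⟨hx, hi, hinj⟩
    have hU : x ∈ cfU := ⟨hx, hi⟩
    have hinj' : Function.Injective (fun n => cfDigit n x) := by
      intro m n h
      by_contra hne
      exact hinj m n hne h
    have ht := hinj'.tendsto_cofinite
    rw [Nat.cofinite_eq_atTop] at ht
    obtain ⟨m, hm⟩ := eventually_atTop.1 (tendsto_atTop.1 ht N)
    have hUm : ∀ m, gaussMap^[m] x ∈ cfU := by
      intro m
      induction m with
      | zero => exact hU
      | succ m ih => rw [Function.iterate_succ_apply']; exact (cfU_step ih).1
    refine mem_iUnion.2 ⟨m, hU, hUm m, fun i => ?_⟩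
    have := hm (i + m) (by omega)
    simpa [cfDigit, Function.iterate_add_apply] using this
  refine (dimH_mono hsub).trans ?_
  rw [dimH_iUnion]
  exact iSup_le fun m => dimH_preim_iter m

lemma exists_cf {α : Type*} (σ : α → α) (a : α → ℕ) (ha : ∀ p, 2 ≤ a p) :
    ∃ X : α → ℝ, ∀ p, 0 < X p ∧ X p ≤ 1 / 2 ∧ X p = ((a p : ℝ) + X (σ p))⁻¹ := by
  have ha' : ∀ p, (2 : ℝ) ≤ a p := fun p => by exact_mod_cast ha p
  let T : (α → ℝ) → α → ℝ := fun g p => ((a p : ℝ) + g (σ p))⁻¹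
  let S : ℕ → α → ℝ := fun k => T^[k] (fun _ => 0)
  have hS : ∀ k p, S (k + 1) p = ((a p : ℝ) + S k (σ p))⁻¹ := by
    intro k p
    simp only [S, Function.iterate_succ_apply']
    rfl
  have h0 : ∀ k p, 0 ≤ S k p := by
    intro k
    induction k with
    | zero => intro p; exact le_rfl
    | succ k ih => intro p; rw [hS]; have := ih (σ p); positivity
  have h1 : ∀ k p, dist (S k p) (S (k + 1) p) ≤ 1 * (1 / 4 : ℝ) ^ k := by
    intro k
    induction k with
    | zero =>
      intro p
      have h := ha' p
      rw [Real.dist_eq, abs_sub_comm, hS]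
      simp only [S, Function.iterate_zero, id]
      rw [add_zero, sub_zero, abs_of_nonneg (by positivity)]
      simpa using inv_le_one_of_one_le₀ (by linarith)
    | succ k ih =>
      intro p
      rw [hS k, hS (k + 1), Real.dist_eq]
      have h := ha' p
      refine (inv_sub_le (c := 2) (by norm_num) (by linarith [h0 k (σ p)])
        (by linarith [h0 (k + 1) (σ p)])).trans ?_
      have := ih (σ p)
      rw [Real.dist_eq] at this
      rw [add_sub_add_left_eq_sub, pow_succ (1 / 4 : ℝ)]
      norm_num at this ⊢
      linarith
  have h2 : ∀ p, ∃ l, Tendsto (fun k => S k p) atTop (𝓝 l) := fun p =>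
    cauchySeq_tendsto_of_complete
      (cauchySeq_of_le_geometric (1 / 4) 1 (by norm_num) (fun k => h1 k p))
  choose X hX using h2
  have hX0 : ∀ p, 0 ≤ X p := fun p => ge_of_tendsto' (hX p) (fun k => h0 k p)
  have heq : ∀ p, X p = ((a p : ℝ) + X (σ p))⁻¹ := by
    intro p
    have t1 := (hX p).comp (tendsto_add_atTop_nat 1)
    have t2 : Tendsto (fun k => ((a p : ℝ) + S k (σ p))⁻¹) atTop (𝓝 ((a p : ℝ) + X (σ p))⁻¹) :=
      ((hX (σ p)).const_add _).inv₀ (by have := ha' p; have := hX0 (σ p); positivity)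
    refine tendsto_nhds_unique t1 (t2.congr fun k => (hS k p).symm)
  refine ⟨X, fun p => ?_⟩
  have h := ha' p
  have h' := hX0 (σ p)
  refine ⟨?_, ?_, heq p⟩
  · rw [heq p]; positivity
  · rw [heq p, one_div]
    exact inv_anti₀ (by norm_num) (by linarith)

/-- Mixed radix shift. -/
noncomputable def mrS (p : ℕ × ℝ) : ℕ × ℝ := (p.1 + 1, Int.fract (2 ^ (p.1 + 1) * p.2))

/-- The digit attached to a level and a point. -/
noncomputable def mrA (p : ℕ × ℝ) : ℕ := 2 ^ (p.1 + 1) + ⌊(2 : ℝ) ^ (p.1 + 1) * p.2⌋₊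

lemma mrA_ge (p : ℕ × ℝ) : 2 ^ (p.1 + 1) ≤ mrA p := Nat.le_add_right _ _

lemma mrA_two (p : ℕ × ℝ) : 2 ≤ mrA p := by
  refine le_trans ?_ (mrA_ge p)
  have := Nat.one_le_two_pow (n := p.1)
  rw [pow_succ]; omega

lemma mrA_lt {p : ℕ × ℝ} (h : p.2 ∈ Set.Ico (0 : ℝ) 1) : mrA p < 2 ^ (p.1 + 2) := by
  have : ⌊(2 : ℝ) ^ (p.1 + 1) * p.2⌋₊ < 2 ^ (p.1 + 1) := by
    rw [Nat.floor_lt (by have := h.1; positivity)]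
    push_cast
    have h2 := h.2
    have : (0 : ℝ) < 2 ^ (p.1 + 1) := by positivity
    nlinarith
  unfold mrA
  rw [pow_succ 2 (p.1 + 1)]
  omega

lemma mrS_mem (p : ℕ × ℝ) : (mrS p).2 ∈ Set.Ico (0 : ℝ) 1 :=
  ⟨Int.fract_nonneg _, Int.fract_lt_one _⟩

lemma mr_eq {p : ℕ × ℝ} (h : p.2 ∈ Set.Ico (0 : ℝ) 1) :
    (2 : ℝ) ^ (p.1 + 1) * p.2 + 2 ^ (p.1 + 1) = mrA p + (mrS p).2 := by
  have h1 := h.1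
  have : ((⌊(2 : ℝ) ^ (p.1 + 1) * p.2⌋₊ : ℕ) : ℝ) = (⌊(2 : ℝ) ^ (p.1 + 1) * p.2⌋ : ℝ) :=
    natCast_floor_eq_intCast_floor (by positivity)
  simp only [mrA, mrS]
  push_cast
  rw [this]
  have := Int.floor_add_fract ((2 : ℝ) ^ (p.1 + 1) * p.2)
  linarith

lemma holder_key {X : ℕ × ℝ → ℝ}
    (hX : ∀ p, 0 < X p ∧ X p ≤ 1 / 2 ∧ X p = ((mrA p : ℝ) + X (mrS p))⁻¹)
    {r : ℝ} (hr0 : 0 < r) (hr1 : r ≤ 1) {n₀ : ℕ}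
    (hn : ∀ n : ℕ, n₀ ≤ n → (32 * ((2 : ℝ) ^ n) ^ 2) ^ r ≤ 2 * 2 ^ n) (k : ℕ) :
    ∀ n, n₀ ≤ n → ∀ y ∈ Set.Ico (0 : ℝ) 1, ∀ z ∈ Set.Ico (0 : ℝ) 1,
      |y - z| ≤ 32 * (2 ^ n * |X (n, y) - X (n, z)|) ^ r + (1 / 2) ^ k := by
  induction k with
  | zero =>
    intro n _ y hy z hz
    have : |y - z| ≤ 1 := abs_le.2 ⟨by linarith [hy.1, hz.2], by linarith [hy.2, hz.1]⟩
    have h2 : 0 ≤ 32 * (2 ^ n * |X (n, y) - X (n, z)|) ^ r := by positivity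
    simp only [pow_zero]
    linarith
  | succ k ih =>
    intro n hnn y hy z hz
    have ey := mr_eq (p := (n, y)) hy
    have ez := mr_eq (p := (n, z)) hz
    obtain ⟨-, -, xy⟩ := hX (n, y)
    obtain ⟨-, -, xz⟩ := hX (n, z)
    obtain ⟨py, qy, -⟩ := hX (mrS (n, y))
    obtain ⟨pz, qz, -⟩ := hX (mrS (n, z))
    have ay := mrA_lt (p := (n, y)) hy
    have az := mrA_lt (p := (n, z)) hz
    have gy' := mrA_ge (n, y)
    have gz' := mrA_ge (n, z)
    have my := mrS_mem (n, y)
    have mz := mrS_mem (n, z)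
    have ih' := ih (n + 1) (by omega) _ my _ mz
    have sy : ((n + 1, (mrS (n, y)).2) : ℕ × ℝ) = mrS (n, y) := rfl
    have sz : ((n + 1, (mrS (n, z)).2) : ℕ × ℝ) = mrS (n, z) := rfl
    rw [sy, sz] at ih'
    have hn' := hn n hnn
    set N : ℝ := 2 ^ n with hNdef
    have hN : 1 ≤ N := one_le_pow₀ (by norm_num)
    have hN1 : (2 : ℝ) ^ (n + 1) = 2 * N := by rw [pow_succ]; ring
    have hN2 : (2 : ℝ) ^ (n + 2) = 4 * N := by rw [pow_add]; ring
    set A := mrA (n, y)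
    set B := mrA (n, z)
    set u := X (mrS (n, y))
    set v := X (mrS (n, z))
    set y' := (mrS (n, y)).2
    set z' := (mrS (n, z)).2
    simp only [hN1] at ey ez ih'
    have Ay : (A : ℝ) + 1 ≤ 4 * N := by rw [← hN2]; exact_mod_cast ay
    have Az : (B : ℝ) + 1 ≤ 4 * N := by rw [← hN2]; exact_mod_cast az
    have Ay' : 2 * N ≤ (A : ℝ) := by rw [← hN1]; exact_mod_cast gy'
    have Az' : 2 * N ≤ (B : ℝ) := by rw [← hN1]; exact_mod_cast gz'
    have hΔ : |(A + u) - (B + v)| ≤ 16 * N ^ 2 * |X (n, y) - X (n, z)| := by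
      rw [xy, xz]
      have e : (A + u) - (B + v) = ((A + u) * (B + v)) * ((B + v)⁻¹ - (A + u)⁻¹) := by
        have : (A + u) ≠ 0 := by positivity
        have : (B + v) ≠ 0 := by positivity
        field_simp
      rw [e, abs_mul, abs_sub_comm (B + v)⁻¹, abs_of_pos (by positivity)]
      refine mul_le_mul_of_nonneg_right ?_ (abs_nonneg _)
      calc (A + u) * (B + v) ≤ (4 * N) * (4 * N) := by gcongr <;> linarith
        _ = 16 * N ^ 2 := by ring
    set Δ := |X (n, y) - X (n, z)|
    have hΔ0 : 0 ≤ Δ := abs_nonneg _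
    have hyz : 2 * N * |y - z| = |(A - B : ℝ) + (y' - z')| := by
      have e : (A - B : ℝ) + (y' - z') = 2 * N * (y - z) := by linarith
      rw [e, abs_mul, abs_of_pos (by positivity : 0 < 2 * N)]
    have hy'z' : |y' - z'| ≤ 1 := abs_le.2 ⟨by linarith [my.1, mz.2], by linarith [my.2, mz.1]⟩
    by_cases hAB : A = B
    · rw [hAB, sub_self, zero_add] at hyz
      rw [hAB, add_sub_add_left_eq_sub] at hΔ
      have h1 : (2 * N * |u - v|) ^ r ≤ 2 * N * (N * Δ) ^ r := by
        calc (2 * N * |u - v|) ^ r ≤ ((32 * N ^ 2) * (N * Δ)) ^ r := by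
              apply Real.rpow_le_rpow (by positivity) _ hr0.le
              nlinarith
          _ = (32 * N ^ 2) ^ r * (N * Δ) ^ r := Real.mul_rpow (by positivity) (by positivity)
          _ ≤ _ := by gcongr
      have h2 : 2 * N * |y - z| ≤ 2 * N * (32 * (N * Δ) ^ r + (1 / 2) ^ (k + 1)) := by
        rw [hyz]
        have h3 : (1 / 2 : ℝ) ^ k ≤ N * (1 / 2) ^ k := le_mul_of_one_le_left (by positivity) hN
        calc |y' - z'| ≤ 32 * (2 * N * (N * Δ) ^ r) + N * (1 / 2) ^ k := by linarith
          _ = _ := by rw [pow_succ]; ring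
      exact le_of_mul_le_mul_left h2 (by positivity)
    · have hk1 : (1 : ℝ) ≤ |(A - B : ℝ)| := by
        have : (1 : ℤ) ≤ |(A - B : ℤ)| := Int.one_le_abs (by omega)
        exact_mod_cast this
      set K := |(A - B : ℝ)|
      have hK2 : K ≤ 2 * N := abs_le.2 ⟨by linarith, by linarith⟩
      have h1 : 2 * N * |y - z| ≤ 2 * K := by
        rw [hyz]
        exact (abs_add_le _ _).trans (by linarith)
      have h2 : K / 2 ≤ |(A + u) - (B + v)| := by
        have e : (A - B : ℝ) = ((A + u) - (B + v)) + (v - u) := by ring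
        have h3 : K ≤ |(A + u) - (B + v)| + |v - u| := by
          simp only [K]
          nth_rewrite 1 [e]
          exact abs_add_le _ _
        have : |v - u| ≤ 1 / 2 := abs_le.2 ⟨by linarith, by linarith⟩
        linarith
      have hN0 : 0 < N := by linarith
      have h4 : K / N / 32 ≤ N * Δ := by
        rw [div_div, div_le_iff₀ (by positivity)]
        nlinarith
      have h5 : K / N / 32 ≤ 1 := by
        rw [div_div, div_le_one (by positivity)]
        linarith
      have h6 : |y - z| ≤ K / N := by
        rw [le_div_iff₀ hN0]; linarith
      have h7 : K / N / 32 ≤ (N * Δ) ^ r :=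
        (Real.self_le_rpow_of_le_one (by positivity) h5 hr1).trans
          (Real.rpow_le_rpow (by positivity) h4 hr0.le)
      have h8 : (0 : ℝ) ≤ (1 / 2) ^ (k + 1) := by positivity
      linarith

lemma exists_n0 {r : ℝ} (hr0 : 0 < r) (hr : r < 1 / 2) :
    ∃ n₀ : ℕ, ∀ n : ℕ, n₀ ≤ n → (32 * ((2 : ℝ) ^ n) ^ 2) ^ r ≤ 2 * 2 ^ n := by
  have h1 : Tendsto (fun n : ℕ => ((2 : ℝ) ^ n) ^ (1 - 2 * r)) atTop atTop :=
    (tendsto_rpow_atTop (by linarith)).comp (tendsto_pow_atTop_atTop_of_one_lt (r := (2 : ℝ)) (by norm_num))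
  obtain ⟨n₀, h⟩ := eventually_atTop.1 (tendsto_atTop.1 h1 16)
  refine ⟨n₀, fun n hn => ?_⟩
  have h2 := h n hn
  set N : ℝ := 2 ^ n
  have hN : 0 < N := by positivity
  rw [Real.mul_rpow (by norm_num) (by positivity), ← Real.rpow_two, ← Real.rpow_mul hN.le]
  have h3 : (32 : ℝ) ^ r ≤ 32 := by
    nth_rewrite 2 [← Real.rpow_one 32]
    exact Real.rpow_le_rpow_of_exponent_le (by norm_num) (by linarith)
  have h4 : N ^ (1 - 2 * r) * N ^ (2 * r) = N := by
    rw [← Real.rpow_add hN]; simp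
  have h5 : 0 < N ^ (2 * r) := by positivity
  nlinarith

lemma cf_iter {X : ℕ × ℝ → ℝ}
    (hX : ∀ p, 0 < X p ∧ X p ≤ 1 / 2 ∧ X p = ((mrA p : ℝ) + X (mrS p))⁻¹) (p : ℕ × ℝ) (i : ℕ) :
    gaussMap^[i] (X p) = X (mrS^[i] p) := by
  induction i with
  | zero => rfl
  | succ i ih =>
    rw [Function.iterate_succ_apply', ih, Function.iterate_succ_apply', gaussMap]
    set q := mrS^[i] p
    obtain ⟨_, _, h⟩ := hX q
    obtain ⟨h1, h2, _⟩ := hX (mrS q)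
    rw [h, inv_inv, Int.fract_natCast_add, Int.fract_eq_self]
    exact ⟨h1.le, by linarith⟩

lemma cf_digit {X : ℕ × ℝ → ℝ}
    (hX : ∀ p, 0 < X p ∧ X p ≤ 1 / 2 ∧ X p = ((mrA p : ℝ) + X (mrS p))⁻¹) (p : ℕ × ℝ) (i : ℕ) :
    cfDigit i (X p) = mrA (mrS^[i] p) := by
  rw [cfDigit, cf_iter hX]
  set q := mrS^[i] p
  obtain ⟨_, _, h⟩ := hX q
  obtain ⟨h1, h2, _⟩ := hX (mrS q)
  rw [h, inv_inv, Nat.floor_eq_iff (by positivity)]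
  exact ⟨by linarith, by linarith⟩

lemma mr_level (p : ℕ × ℝ) (i : ℕ) : (mrS^[i] p).1 = p.1 + i := by
  induction i with
  | zero => rfl
  | succ i ih => rw [Function.iterate_succ_apply', mrS, ih]; rfl

lemma mr_mem {p : ℕ × ℝ} (hp : p.2 ∈ Set.Ico (0 : ℝ) 1) (i : ℕ) :
    (mrS^[i] p).2 ∈ Set.Ico (0 : ℝ) 1 := by
  cases i with
  | zero => exact hp
  | succ i => rw [Function.iterate_succ_apply']; exact mrS_mem _

lemma cf_digit_strictMono {X : ℕ × ℝ → ℝ}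
    (hX : ∀ p, 0 < X p ∧ X p ≤ 1 / 2 ∧ X p = ((mrA p : ℝ) + X (mrS p))⁻¹) {p : ℕ × ℝ}
    (hp : p.2 ∈ Set.Ico (0 : ℝ) 1) : StrictMono (fun i => cfDigit i (X p)) := by
  apply strictMono_nat_of_lt_succ
  intro i
  simp only [cf_digit hX]
  refine (mrA_lt (mr_mem hp i)).trans_le (le_trans (le_of_eq ?_) (mrA_ge _))
  rw [mr_level, mr_level]; ring

lemma lower_bound : 1 / 2 ≤ dimH {x : ℝ | x ∈ Set.Ioo (0 : ℝ) 1 ∧ Irrational x ∧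
    ∀ m n : ℕ, m ≠ n → cfDigit m x ≠ cfDigit n x} := by
  refine le_of_forall_lt_imp_le_of_dense fun c hc => ?_
  rcases eq_or_ne c 0 with rfl | hc0
  · exact bot_le
  lift c to ℝ≥0 using (hc.trans (by simp)).ne
  have hcpos : 0 < c := pos_iff_ne_zero.2 (by simpa using hc0)
  have hc2 : (c : ℝ) < 1 / 2 := by
    have h2 : ((1 / 2 : ℝ≥0) : ℝ≥0∞) = 1 / 2 := by
      rw [ENNReal.coe_div (by norm_num)]
      simp
    rw [← h2, ENNReal.coe_lt_coe] at hc
    exact_mod_cast hc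
  have hcpos' : (0 : ℝ) < c := hcpos
  obtain ⟨n, hn⟩ := exists_n0 hcpos' hc2
  obtain ⟨X, hX⟩ := exists_cf mrS mrA mrA_two
  have key : ∀ y ∈ Set.Ico (0 : ℝ) 1, ∀ z ∈ Set.Ico (0 : ℝ) 1,
      |y - z| ≤ 32 * (2 ^ n * |X (n, y) - X (n, z)|) ^ (c : ℝ) := by
    intro y hy z hz
    have ht : Tendsto (fun k : ℕ => 32 * (2 ^ n * |X (n, y) - X (n, z)|) ^ (c : ℝ) +
        (1 / 2 : ℝ) ^ k) atTop (𝓝 (32 * (2 ^ n * |X (n, y) - X (n, z)|) ^ (c : ℝ) + 0)) :=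
      (tendsto_pow_atTop_nhds_zero_of_lt_one (by norm_num) (by norm_num)).const_add _
    rw [add_zero] at ht
    exact ge_of_tendsto' ht fun k =>
      holder_key hX hcpos' (by linarith) hn k n le_rfl y hy z hz
  let g : ℝ → ℝ := fun y => X (n, y)
  have hinj : Set.InjOn g (Set.Ico 0 1) := by
    intro y hy z hz h
    have := key y hy z hz
    simp only [g] at h
    rw [h, sub_self, abs_zero, mul_zero, Real.zero_rpow hcpos'.ne', mul_zero] at this
    exact sub_eq_zero.1 (abs_eq_zero.1 (le_antisymm this (abs_nonneg _)))
  let f : ℝ → ℝ := Function.invFunOn g (Set.Ico 0 1)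
  have hf : ∀ y ∈ Set.Ico (0 : ℝ) 1, f (g y) = y := fun y hy => hinj.leftInvOn_invFunOn hy
  have hhold : HolderOnWith (32 * (2 ^ n) ^ (c : ℝ)) c f (g '' Set.Ico 0 1) := by
    rintro _ ⟨y, hy, rfl⟩ _ ⟨z, hz, rfl⟩
    rw [hf y hy, hf z hz, edist_nndist, edist_nndist, ← ENNReal.coe_rpow_of_nonneg _ hcpos'.le,
      ← ENNReal.coe_mul, ENNReal.coe_le_coe, ← NNReal.coe_le_coe]
    push_cast
    rw [Real.dist_eq, Real.dist_eq, mul_assoc, ← Real.mul_rpow (by positivity) (by positivity)]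
    exact key y hy z hz
  have himg : f '' (g '' Set.Ico 0 1) = Set.Ico 0 1 := by
    rw [← Set.image_comp]
    exact (Set.image_congr (fun y hy => hf y hy)).trans (Set.image_id' _)
  have hd := hhold.dimH_image_le hcpos
  have h1 : dimH (Set.Ico (0 : ℝ) 1) = 1 := by
    rw [Real.dimH_of_nonempty_interior (by simp)]; simp
  rw [himg, h1] at hd
  have hd' : (c : ℝ≥0∞) ≤ dimH (g '' Set.Ico 0 1) := by
    rw [ENNReal.le_div_iff_mul_le (by simp [hcpos.ne']) (by simp), one_mul] at hd
    exact hd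
  refine hd'.trans ?_
  have hsub : g '' Set.Ico 0 1 ⊆ {x : ℝ | x ∈ Set.Ioo (0 : ℝ) 1 ∧ Irrational x ∧
      ∀ m n : ℕ, m ≠ n → cfDigit m x ≠ cfDigit n x} ∪ Set.range ((↑) : ℚ → ℝ) := by
    rintro _ ⟨y, hy, rfl⟩
    by_cases hi : Irrational (g y)
    · left
      obtain ⟨h1, h2, _⟩ := hX (n, y)
      refine ⟨⟨h1, by simp only [g]; linarith⟩, hi, fun i j hij h => hij ?_⟩
      exact (cf_digit_strictMono hX (p := (n, y)) hy).injective h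
    · right
      exact not_not.1 hi
  refine (dimH_mono hsub).trans ?_
  rw [dimH_union, dimH_countable (Set.countable_range _)]
  simp

/-- The set `E` of irrationals in `(0,1)` with pairwise distinct regular continued
fraction digits has Hausdorff dimension `1/2`. -/
theorem stmt14 :
    dimH {x : ℝ | x ∈ Set.Ioo (0 : ℝ) 1 ∧ Irrational x ∧
        ∀ m n : ℕ, m ≠ n → cfDigit m x ≠ cfDigit n x} = 1 / 2 :=
  le_antisymm upper_bound lower_bound
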